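/- Let k ≥ 1, n₁,…,n_k ≥ 2, N = ∏_{i=1}^k n_i, and let S = conv(⊗_{i=1}^k P_{n_i}) be the set of multipartite separable states in H_N. Define the ℝ-linear map L₀ : H_N → H_N by L₀(A) = (tr A / N) I_N, and let L₁ : H_N → H_N be any ℝ-linear map satisfying tr(L₁(A)) = 0 for all A ∈ H_N. Then there exists τ > 0 (depending on L₁) such that for every real t with |t| < τ, the map L₀ + t L₁ satisfies (L₀ + t L₁)(S) ⊆ S. -/

import Mathlib

open Matrix

/-- A pure state: a rank-one Hermitian matrix of trace one. -/
def IsPureState {m : ℕ} (A : Matrix (Fin m) (Fin m) ℂ) : Prop :=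
  A.IsHermitian ∧ A.rank = 1 ∧ A.trace = 1

/-- The tensor (Kronecker) product `⊗_{i=1}^k A_i` of matrices `A_i` of sizes `n_i × n_i`:
the `N × N` matrix (`N = ∏ n_i`) with entries
`(⊗ A_i)((x₁,…,x_k),(y₁,…,y_k)) = ∏_i A_i(x_i, y_i)`. -/
def tensorPi {k : ℕ} {n : Fin k → ℕ} (A : ∀ i, Matrix (Fin (n i)) (Fin (n i)) ℂ) :
    Matrix (∀ i, Fin (n i)) (∀ i, Fin (n i)) ℂ :=
  Matrix.of fun x y => ∏ i, A i (x i) (y i)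

/-- The set of pure product states `⊗_{i=1}^k P_{n_i}` inside `H_N`. -/
def PureTensor {k : ℕ} (n : Fin k → ℕ) :
    Set (selfAdjoint (Matrix (∀ i, Fin (n i)) (∀ i, Fin (n i)) ℂ)) :=
  {C | ∃ Q : ∀ i, Matrix (Fin (n i)) (Fin (n i)) ℂ, (∀ i, IsPureState (Q i)) ∧
    (C : Matrix (∀ i, Fin (n i)) (∀ i, Fin (n i)) ℂ) = tensorPi Q}

open scoped ComplexStarModule

/-- directions in which `c` can be moved a little inside `S` -/
def absorbDir {V : Type*} [AddCommGroup V] [Module ℝ V] (S : Set V) (hS : Convex ℝ S) (c : V)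
    (hc : c ∈ S) : Submodule ℝ V where
  carrier := {B | ∃ ε : ℝ, 0 < ε ∧ ∀ s : ℝ, |s| ≤ ε → c + s • B ∈ S}
  zero_mem' := ⟨1, one_pos, fun s _ => by simpa using hc⟩
  add_mem' := by
    rintro a b ⟨e, he, h⟩ ⟨f, hf, h'⟩
    refine ⟨min e f / 2, by positivity, fun s hs => ?_⟩
    have h1 : |2 * s| ≤ min e f := by rw [abs_mul, abs_two]; linarith
    have := hS (h (2 * s) (h1.trans (min_le_left _ _))) (h' (2 * s) (h1.trans (min_le_right _ _)))
      (by norm_num : (0:ℝ) ≤ 1/2) (by norm_num : (0:ℝ) ≤ 1/2) (by norm_num)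
    convert this using 1
    module
  smul_mem' := by
    rintro r a ⟨e, he, h⟩
    refine ⟨e / (|r| + 1), by positivity, fun s hs => ?_⟩
    rw [smul_smul]
    apply h
    rw [abs_mul]
    rw [le_div_iff₀ (by positivity)] at hs
    nlinarith [abs_nonneg s, abs_nonneg r]

theorem absorb_uniform {V ι : Type*} [AddCommGroup V] [Module ℝ V] (S : Set V)
    (hS : Convex ℝ S) (c : V) (hc : c ∈ S) (B : ι → V) (hB : ∀ j, B j ∈ absorbDir S hS c hc)
    (F : Finset ι) : ∃ ε : ℝ, 0 < ε ∧ ∀ a : ι → ℝ, (∀ j, |a j| ≤ 1) → ∀ t : ℝ, |t| ≤ ε →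
      c + t • ∑ j ∈ F, a j • B j ∈ S := by
  classical
  induction F using Finset.induction_on with
  | empty => exact ⟨1, one_pos, fun a _ t _ => by simpa using hc⟩
  | insert j F hj ih =>
    obtain ⟨e, he, h⟩ := ih
    obtain ⟨f, hf, h'⟩ := hB j
    refine ⟨min e f / 2, by positivity, fun a ha s hs => ?_⟩
    have h1 : |2 * s| ≤ min e f := by rw [abs_mul, abs_two]; linarith
    have h2 : |2 * s * a j| ≤ f := by
      rw [abs_mul]
      have := h1.trans (min_le_right _ _)
      nlinarith [abs_nonneg (2 * s), abs_nonneg (a j), ha j]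
    have := hS (h a ha (2 * s) (h1.trans (min_le_left _ _))) (h' _ h2)
      (by norm_num : (0:ℝ) ≤ 1/2) (by norm_num : (0:ℝ) ≤ 1/2) (by norm_num)
    rw [Finset.sum_insert hj]
    convert this using 1
    module

theorem isPure_vec {m : ℕ} (v : Fin m → ℂ) (hv : ∑ i, v i * star (v i) = 1) :
    IsPureState (vecMulVec v (star v)) := by
  have htr : (vecMulVec v (star v)).trace = 1 := by
    simpa [Matrix.trace, vecMulVec_apply] using hv
  refine ⟨?_, ?_, htr⟩
  · ext i j; simp [vecMulVec_apply, mul_comm]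
  · have h1 : (vecMulVec v (star v)).rank ≤ 1 := rank_vecMulVec_le _ _
    have h0 : (vecMulVec v (star v)).rank ≠ 0 := by
      intro h
      rw [Matrix.rank, Submodule.finrank_eq_zero, LinearMap.range_eq_bot] at h
      have h' : vecMulVec v (star v) = 0 :=
        Matrix.toLin'.injective ((Matrix.toLin'_apply' _).trans (h.trans (map_zero _).symm))
      rw [h'] at htr
      simp at htr
    omega

theorem pure_resolution {m : ℕ} (Q : Matrix (Fin m) (Fin m) ℂ) (hQ : IsPureState Q) :
    ∃ v : Fin m → Fin m → ℂ, (∀ j, ∑ i, v j i * star (v j i) = 1) ∧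
      (∑ j, vecMulVec (v j) (star (v j)) = 1) ∧ ∃ j, Q = vecMulVec (v j) (star (v j)) := by
  obtain ⟨hH, hr, ht⟩ := hQ
  let U : Matrix (Fin m) (Fin m) ℂ := hH.eigenvectorUnitary
  have hU1 : star U * U = 1 := Unitary.coe_star_mul_self hH.eigenvectorUnitary
  have hU2 : U * star U = 1 := Unitary.coe_mul_star_self hH.eigenvectorUnitary
  refine ⟨fun j i => U i j, fun j => ?_, ?_, ?_⟩
  · have := congrFun (congrFun hU1 j) j
    rw [Matrix.mul_apply] at this
    simpa [Matrix.star_apply, mul_comm] using this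
  · rw [← hU2]
    ext a b
    simp [Matrix.sum_apply, vecMulVec_apply, Matrix.mul_apply, Matrix.star_apply]
  · have hs := hH.spectral_theorem
    rw [hH.rank_eq_card_non_zero_eigs, Fintype.card_eq_one_iff] at hr
    obtain ⟨⟨j, hj⟩, hu⟩ := hr
    have hz : ∀ l, l ≠ j → hH.eigenvalues l = 0 := by
      intro l hl
      by_contra h
      exact hl (congrArg Subtype.val (hu ⟨l, h⟩))
    have h1 : (hH.eigenvalues j : ℂ) = 1 := by
      rw [hH.trace_eq_sum_eigenvalues, Finset.sum_eq_single j] at ht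
      · exact ht
      · intro l _ hl; simp [hz l hl]
      · simp
    refine ⟨j, ?_⟩
    have hs' : Q = U * diagonal (RCLike.ofReal ∘ hH.eigenvalues) * star U := by
      simpa [Unitary.conjStarAlgAut_apply] using hs
    ext a b
    rw [hs', Matrix.mul_apply, Finset.sum_eq_single j]
    · have h1' : (RCLike.ofReal (hH.eigenvalues j) : ℂ) = 1 := h1
      simp [vecMulVec_apply, Matrix.mul_diagonal, Matrix.star_apply, h1]
    · intro l _ hl
      simp [Matrix.mul_diagonal, hz l hl]
    · simp

theorem pure_entry_le {m : ℕ} (Q : Matrix (Fin m) (Fin m) ℂ) (hQ : IsPureState Q) (a b) :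
    ‖Q a b‖ ≤ 1 := by
  obtain ⟨v, hv, -, j, rfl⟩ := pure_resolution Q hQ
  have key : ∀ a, ‖v j a‖ ≤ 1 := by
    intro a
    have h : ∑ i, ‖v j i‖ ^ 2 = 1 := by
      have := hv j
      simp only [Complex.star_def, Complex.mul_conj, Complex.normSq_eq_norm_sq] at this
      exact_mod_cast this
    have h2 : ‖v j a‖ ^ 2 ≤ 1 := h ▸ Finset.single_le_sum (f := fun i => ‖v j i‖ ^ 2)
      (fun i _ => by positivity) (Finset.mem_univ a)
    nlinarith [norm_nonneg (v j a)]
  rw [vecMulVec_apply, norm_mul, Pi.star_apply, norm_star]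
  exact mul_le_one₀ (key a) (norm_nonneg _) (key b)

theorem single_pure {m : ℕ} (i j : Fin m) : ∃ (c : Fin 4 → ℂ)
    (Q : Fin 4 → Matrix (Fin m) (Fin m) ℂ), (∀ a, IsPureState (Q a)) ∧
      Matrix.single i j (1 : ℂ) = ∑ a, c a • Q a := by
  have hE : ∀ i : Fin m, IsPureState (vecMulVec (Pi.single i (1:ℂ)) (star (Pi.single i (1:ℂ)))) := by
    intro i
    apply isPure_vec
    rw [Finset.sum_eq_single i] <;> simp +contextual
  by_cases hij : i = j
  · subst hij
    refine ⟨![1, 0, 0, 0], fun _ => _, fun _ => hE i, ?_⟩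
    simp only [Fin.sum_univ_four]
    ext a b
    simp [vecMulVec_apply, Matrix.single_apply, Pi.single_apply]
    grind
  · have hs : ((Real.sqrt 2 : ℝ) : ℂ)⁻¹ * ((Real.sqrt 2 : ℝ) : ℂ)⁻¹ = 1 / 2 := by
      rw [← mul_inv, ← Complex.ofReal_mul, Real.mul_self_sqrt (by norm_num)]; norm_num
    have hF : ∀ w : ℂ, w * star w = 1 →
        IsPureState (vecMulVec (((Real.sqrt 2 : ℝ) : ℂ)⁻¹ • (Pi.single i (1:ℂ) + Pi.single j w))
          (star (((Real.sqrt 2 : ℝ) : ℂ)⁻¹ • (Pi.single i (1:ℂ) + Pi.single j w)))) := by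
      intro w hw
      apply isPure_vec
      have : ∀ l, ((((Real.sqrt 2 : ℝ) : ℂ)⁻¹ • (Pi.single i (1:ℂ) + Pi.single j w) : Fin m → ℂ) l) *
          star ((((Real.sqrt 2 : ℝ) : ℂ)⁻¹ • (Pi.single i (1:ℂ) + Pi.single j w) : Fin m → ℂ) l) =
          (if l = i then 1 / 2 else 0) + (if l = j then 1 / 2 else 0) := by
        intro l
        have hw' : w * (starRingEnd ℂ) w = 1 := hw
        simp only [Pi.smul_apply, Pi.add_apply, Pi.single_apply, smul_eq_mul, star_mul', star_add,
          Complex.star_def, map_inv₀, Complex.conj_ofReal]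
        split_ifs with h1 h2 h2
        · exact absurd (h1.symm.trans h2) hij
        · simp; linear_combination hs
        · simp; linear_combination hs * w * (starRingEnd ℂ) w + hw' / 2
        · simp
      simp_rw [this]
      rw [Finset.sum_add_distrib]
      simp
      norm_num
    refine ⟨![1, Complex.I, -(1 + Complex.I) / 2, -(1 + Complex.I) / 2],
      ![vecMulVec (((Real.sqrt 2 : ℝ) : ℂ)⁻¹ • (Pi.single i (1:ℂ) + Pi.single j (1:ℂ)))
          (star (((Real.sqrt 2 : ℝ) : ℂ)⁻¹ • (Pi.single i (1:ℂ) + Pi.single j (1:ℂ)))),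
        vecMulVec (((Real.sqrt 2 : ℝ) : ℂ)⁻¹ • (Pi.single i (1:ℂ) + Pi.single j Complex.I))
          (star (((Real.sqrt 2 : ℝ) : ℂ)⁻¹ • (Pi.single i (1:ℂ) + Pi.single j Complex.I))),
        vecMulVec (Pi.single i (1:ℂ)) (star (Pi.single i (1:ℂ))),
        vecMulVec (Pi.single j (1:ℂ)) (star (Pi.single j (1:ℂ)))], ?_, ?_⟩
    · intro a
      fin_cases a
      · exact hF 1 (by simp)
      · exact hF Complex.I (by simp)
      · exact hE i
      · exact hE j
    · simp only [Fin.sum_univ_four]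
      ext a b
      simp only [Matrix.add_apply, Matrix.smul_apply, Matrix.cons_val, vecMulVec_apply,
        Pi.smul_apply, Pi.star_apply, Pi.add_apply, Pi.single_apply, smul_eq_mul, star_mul', star_add,
          Complex.star_def, map_inv₀, Complex.conj_ofReal, Matrix.single_apply]
      have hI := Complex.I_mul_I
      split_ifs <;> simp <;> grind

theorem tensorPi_sum {k : ℕ} {n : Fin k → ℕ} {ι : Fin k → Type*} [∀ i, Fintype (ι i)]
    (R : ∀ i, ι i → Matrix (Fin (n i)) (Fin (n i)) ℂ) :
    tensorPi (fun i => ∑ a, R i a) = ∑ f : (∀ i, ι i), tensorPi (fun i => R i (f i)) := by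
  classical
  ext x y
  simp only [tensorPi, Matrix.of_apply, Matrix.sum_apply]
  rw [Finset.prod_univ_sum, Fintype.piFinset_univ]

theorem tensorPi_smul {k : ℕ} {n : Fin k → ℕ} (c : Fin k → ℂ)
    (R : ∀ i, Matrix (Fin (n i)) (Fin (n i)) ℂ) :
    tensorPi (fun i => c i • R i) = (∏ i, c i) • tensorPi R := by
  ext x y
  simp [tensorPi, Finset.prod_mul_distrib]

theorem tensorPi_single {k : ℕ} {n : Fin k → ℕ} (x y : ∀ i, Fin (n i)) :
    tensorPi (fun i => Matrix.single (x i) (y i) (1:ℂ)) = Matrix.single x y 1 := by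
  ext a b
  simp only [tensorPi, Matrix.of_apply, Matrix.single_apply]
  rw [Fintype.prod_ite_zero]
  simp [funext_iff, forall_and]

theorem tensorPi_one {k : ℕ} {n : Fin k → ℕ} :
    tensorPi (fun i => (1 : Matrix (Fin (n i)) (Fin (n i)) ℂ)) = 1 := by
  ext a b
  simp only [tensorPi, Matrix.of_apply, Matrix.one_apply]
  rw [Fintype.prod_ite_zero]
  simp [funext_iff]

theorem tensorPi_herm {k : ℕ} {n : Fin k → ℕ} (Q : ∀ i, Matrix (Fin (n i)) (Fin (n i)) ℂ)
    (hQ : ∀ i, IsPureState (Q i)) : tensorPi Q ∈ selfAdjoint (Matrix (∀ i, Fin (n i)) (∀ i, Fin (n i)) ℂ) := by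
  rw [selfAdjoint.mem_iff]
  ext a b
  simp only [tensorPi, Matrix.star_apply, Matrix.of_apply, star_prod]
  exact Finset.prod_congr rfl fun i _ => (hQ i).1.apply _ _

theorem tensorPi_trace {k : ℕ} {n : Fin k → ℕ} (Q : ∀ i, Matrix (Fin (n i)) (Fin (n i)) ℂ)
    (hQ : ∀ i, IsPureState (Q i)) : (tensorPi Q).trace = 1 := by
  have : (tensorPi Q).trace = ∏ i, (Q i).trace := by
    simp only [Matrix.trace, tensorPi, Matrix.diag_apply, Matrix.of_apply]
    rw [Finset.prod_univ_sum, Fintype.piFinset_univ]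
  rw [this]
  exact Finset.prod_eq_one fun i _ => (hQ i).2.2

theorem span_pureTensor {k : ℕ} (n : Fin k → ℕ) : Submodule.span ℝ (PureTensor n) = ⊤ := by
  rw [eq_top_iff]
  rintro A -
  -- real and imaginary parts of all matrices lie in the span
  have hsm : ∀ (z : ℂ) (M : Matrix (∀ i, Fin (n i)) (∀ i, Fin (n i)) ℂ),
      ℜ M ∈ Submodule.span ℝ (PureTensor n) → ℑ M ∈ Submodule.span ℝ (PureTensor n) →
      ℜ (z • M) ∈ Submodule.span ℝ (PureTensor n) ∧
      ℑ (z • M) ∈ Submodule.span ℝ (PureTensor n) := by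
    intro z M h1 h2
    rw [realPart_smul, imaginaryPart_smul]
    exact ⟨Submodule.sub_mem _ (Submodule.smul_mem _ _ h1) (Submodule.smul_mem _ _ h2),
      Submodule.add_mem _ (Submodule.smul_mem _ _ h2) (Submodule.smul_mem _ _ h1)⟩
  have hT : ∀ Q : ∀ i, Matrix (Fin (n i)) (Fin (n i)) ℂ, (∀ i, IsPureState (Q i)) →
      ℜ (tensorPi Q) ∈ Submodule.span ℝ (PureTensor n) ∧
      ℑ (tensorPi Q) ∈ Submodule.span ℝ (PureTensor n) := by
    intro Q hQ
    have hs : IsSelfAdjoint (tensorPi Q) := tensorPi_herm Q hQ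
    constructor
    · apply Submodule.subset_span
      exact ⟨Q, hQ, hs.coe_realPart⟩
    · rw [hs.imaginaryPart]; exact Submodule.zero_mem _
  have hE : ∀ x y : ∀ i, Fin (n i),
      ℜ (Matrix.single x y (1:ℂ)) ∈ Submodule.span ℝ (PureTensor n) ∧
      ℑ (Matrix.single x y (1:ℂ)) ∈ Submodule.span ℝ (PureTensor n) := by
    intro x y
    choose c Q hQ hc using fun i => single_pure (x i) (y i)
    have : Matrix.single x y (1:ℂ) = ∑ f : (Fin k → Fin 4), (∏ i, c i (f i)) •
        tensorPi (fun i => Q i (f i)) := by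
      rw [← tensorPi_single]
      simp_rw [hc]
      rw [tensorPi_sum]
      simp_rw [tensorPi_smul]
    rw [this, map_sum, map_sum]
    have h := fun f : (Fin k → Fin 4) => hsm (∏ i, c i (f i)) _
      (hT (fun i => Q i (f i)) fun i => hQ i _).1 (hT (fun i => Q i (f i)) fun i => hQ i _).2
    exact ⟨Submodule.sum_mem _ fun f _ => (h f).1, Submodule.sum_mem _ fun f _ => (h f).2⟩
  have hA : ℜ (A : Matrix (∀ i, Fin (n i)) (∀ i, Fin (n i)) ℂ) = A :=
    Subtype.ext (IsSelfAdjoint.coe_realPart A.2)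
  rw [← hA, Matrix.matrix_eq_sum_single (A : Matrix (∀ i, Fin (n i)) (∀ i, Fin (n i)) ℂ)]
  simp only [map_sum]
  refine Submodule.sum_mem _ fun x _ => Submodule.sum_mem _ fun y _ => ?_
  have := (hsm ((A : Matrix (∀ i, Fin (n i)) (∀ i, Fin (n i)) ℂ) x y) _ (hE x y).1 (hE x y).2).1
  rwa [Matrix.smul_single, smul_eq_mul, mul_one] at this

/-- around the maximally mixed state one can move along any line to a pure product state -/
theorem move_pure {k : ℕ} (n : Fin k → ℕ) (h2 : ∀ i, 2 ≤ n i) (P) (hP : P ∈ PureTensor n)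
    (s : ℝ) (hs : |s| ≤ ((∏ i, n i : ℕ) : ℝ)⁻¹ / 2) :
    (((∏ i, n i : ℕ) : ℝ)⁻¹ • (1 : selfAdjoint (Matrix (∀ i, Fin (n i)) (∀ i, Fin (n i)) ℂ))) +
      s • (P - ((∏ i, n i : ℕ) : ℝ)⁻¹ • 1) ∈ convexHull ℝ (PureTensor n) := by
  classical
  obtain ⟨Q, hQ, hPQ⟩ := hP
  choose v hv hsum j hj using fun i => pure_resolution (Q i) (hQ i)
  have hp : ∀ f : (∀ i, Fin (n i)), ∀ i, IsPureState (vecMulVec (v i (f i)) (star (v i (f i)))) :=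
    fun f i => isPure_vec _ (hv i _)
  let T : (∀ i, Fin (n i)) → selfAdjoint (Matrix (∀ i, Fin (n i)) (∀ i, Fin (n i)) ℂ) :=
    fun f => ⟨tensorPi fun i => vecMulVec (v i (f i)) (star (v i (f i))), tensorPi_herm _ (hp f)⟩
  have hT1 : (1 : selfAdjoint (Matrix (∀ i, Fin (n i)) (∀ i, Fin (n i)) ℂ)) = ∑ f, T f := by
    apply Subtype.ext
    rw [AddSubgroup.val_finsetSum]
    simp only [T]
    rw [← tensorPi_sum (fun i a => vecMulVec (v i a) (star (v i a)))]
    simp_rw [hsum]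
    rw [tensorPi_one]
    rfl
  have hTj : P = T j := by
    apply Subtype.ext
    rw [hPQ]
    simp only [T]
    congr 1
    funext i
    exact hj i
  set N : ℕ := ∏ i, n i with hN
  have hNpos : 1 ≤ N := Finset.prod_pos fun i _ => lt_of_lt_of_le two_pos (h2 i)
  have hNr : (1:ℝ) ≤ N := by exact_mod_cast hNpos
  have hi : (N:ℝ)⁻¹ ≤ 1 := inv_le_one_of_one_le₀ hNr
  have hi0 : 0 < (N:ℝ)⁻¹ := by positivity
  have hcard : Fintype.card (∀ i, Fin (n i)) = N := by simp [hN]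
  let w : (∀ i, Fin (n i)) → ℝ := fun f => (1 - s) * (N:ℝ)⁻¹ + if f = j then s else 0
  have hw0 : ∀ f, 0 ≤ w f := by
    intro f
    obtain ⟨ha, hb⟩ := abs_le.1 hs
    simp only [w]
    split_ifs <;> nlinarith
  have hw1 : ∑ f, w f = 1 := by
    simp only [w]
    rw [Finset.sum_add_distrib, Finset.sum_const, Finset.card_univ, hcard]
    simp
    field_simp
    ring
  have := (convex_convexHull ℝ (PureTensor n)).sum_mem (t := Finset.univ) (w := w) (z := T)
    (fun f _ => hw0 f) hw1 (fun f _ => subset_convexHull ℝ _ ⟨_, hp f, rfl⟩)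
  convert this using 1
  simp only [w, add_smul, Finset.sum_add_distrib, ite_smul, zero_smul]
  rw [← Finset.smul_sum, ← hT1, hTj]
  simp
  module

theorem hull_trace {k : ℕ} (n : Fin k → ℕ) (A) (hA : A ∈ convexHull ℝ (PureTensor n)) :
    (A : Matrix (∀ i, Fin (n i)) (∀ i, Fin (n i)) ℂ).trace = 1 := by
  refine convexHull_min (t := {A : selfAdjoint (Matrix (∀ i, Fin (n i)) (∀ i, Fin (n i)) ℂ) | (A : Matrix (∀ i, Fin (n i)) (∀ i, Fin (n i)) ℂ).trace = 1})
    ?_ ?_ hA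
  · rintro P ⟨Q, hQ, h⟩
    simp only [Set.mem_ofPred_eq]
    rw [h, tensorPi_trace Q hQ]
  · intro a ha b hb r s _ _ hrs
    simp only [Set.mem_ofPred_eq] at *
    simp [Matrix.trace_add, Matrix.trace_smul, ha, hb]
    exact_mod_cast hrs

theorem hull_entry {k : ℕ} (n : Fin k → ℕ) (A) (hA : A ∈ convexHull ℝ (PureTensor n)) (x y) :
    ‖(A : Matrix (∀ i, Fin (n i)) (∀ i, Fin (n i)) ℂ) x y‖ ≤ 1 := by
  refine convexHull_min (t := {A : selfAdjoint (Matrix (∀ i, Fin (n i)) (∀ i, Fin (n i)) ℂ) | ‖(A : Matrix (∀ i, Fin (n i)) (∀ i, Fin (n i)) ℂ) x y‖ ≤ 1})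
    ?_ ?_ hA
  · rintro P ⟨Q, hQ, h⟩
    simp only [Set.mem_ofPred_eq]
    rw [h, tensorPi, Matrix.of_apply, norm_prod]
    exact Finset.prod_le_one (fun _ _ => norm_nonneg _) fun i _ => pure_entry_le _ (hQ i) _ _
  · intro a ha b hb r s hr hs hrs
    simp only [Set.mem_ofPred_eq] at *
    simp only [AddSubgroup.coe_add, selfAdjoint.val_smul, Matrix.add_apply, Matrix.smul_apply]
    refine (norm_add_le _ _).trans ?_
    rw [norm_smul, norm_smul, Real.norm_of_nonneg hr, Real.norm_of_nonneg hs]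
    nlinarith

/-- traceless directions are absorbed -/
theorem traceless_mem {k : ℕ} (n : Fin k → ℕ) (h2 : ∀ i, 2 ≤ n i)
    (hc : ((∏ i, n i : ℕ) : ℝ)⁻¹ • (1 : selfAdjoint (Matrix (∀ i, Fin (n i)) (∀ i, Fin (n i)) ℂ))
      ∈ convexHull ℝ (PureTensor n))
    (B : selfAdjoint (Matrix (∀ i, Fin (n i)) (∀ i, Fin (n i)) ℂ))
    (hB : (B : Matrix (∀ i, Fin (n i)) (∀ i, Fin (n i)) ℂ).trace = 0) :
    B ∈ absorbDir _ (convex_convexHull ℝ (PureTensor n)) _ hc := by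
  have hNpos : 1 ≤ ∏ i, n i := Finset.prod_pos fun i _ => lt_of_lt_of_le two_pos (h2 i)
  set G := absorbDir _ (convex_convexHull ℝ (PureTensor n)) _ hc with hG
  have hBs : B ∈ Submodule.span ℝ (PureTensor n) := by rw [span_pureTensor]; trivial
  have key : B - (B : Matrix (∀ i, Fin (n i)) (∀ i, Fin (n i)) ℂ).trace.re •
      (((∏ i, n i : ℕ) : ℝ)⁻¹ • (1 : selfAdjoint (Matrix (∀ i, Fin (n i)) (∀ i, Fin (n i)) ℂ))) ∈ G := by
    clear hB
    induction hBs using Submodule.span_induction with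
    | mem P hP =>
      rw [hull_trace n P (subset_convexHull ℝ _ hP), Complex.one_re, one_smul]
      refine ⟨((∏ i, n i : ℕ) : ℝ)⁻¹ / 2, ?_, fun s hs => move_pure n h2 P hP s hs⟩
      have : (0:ℝ) < ((∏ i, n i : ℕ) : ℝ) := by exact_mod_cast hNpos
      positivity
    | zero => simp
    | add a b _ _ ha hb =>
      convert G.add_mem ha hb using 1
      simp only [AddSubgroup.coe_add, Matrix.trace_add, Complex.add_re]
      module
    | smul r a _ ha =>
      convert G.smul_mem r ha using 1
      simp only [selfAdjoint.val_smul, Matrix.trace_smul, Complex.smul_re, smul_eq_mul]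
      module
  simpa [hB] using key

/-- Lemma 3.2: let `S = conv(⊗_{i=1}^k P_{n_i})` be the multipartite separable states in
`H_N`, let `L₀(A) = (tr A / N) I_N` and let `L₁ : H_N → H_N` be any `ℝ`-linear map with
`tr(L₁(A)) = 0` for all `A`.  Then there is `τ > 0` such that `(L₀ + t L₁)(S) ⊆ S`
whenever `|t| < τ`. -/
theorem sep_preserving_perturbation (k : ℕ) (hk : 1 ≤ k) (n : Fin k → ℕ)
    (h2 : ∀ i, 2 ≤ n i) (N : ℕ) (hN : N = ∏ i, n i)
    (L₀ L₁ : selfAdjoint (Matrix (∀ i, Fin (n i)) (∀ i, Fin (n i)) ℂ) →ₗ[ℝ]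
          selfAdjoint (Matrix (∀ i, Fin (n i)) (∀ i, Fin (n i)) ℂ))
    (hL₀ : ∀ A, (L₀ A : Matrix (∀ i, Fin (n i)) (∀ i, Fin (n i)) ℂ) =
      ((A : Matrix (∀ i, Fin (n i)) (∀ i, Fin (n i)) ℂ).trace / (N : ℂ)) •
        (1 : Matrix (∀ i, Fin (n i)) (∀ i, Fin (n i)) ℂ))
    (hL₁ : ∀ A, (L₁ A : Matrix (∀ i, Fin (n i)) (∀ i, Fin (n i)) ℂ).trace = 0) :
    ∃ τ : ℝ, 0 < τ ∧ ∀ t : ℝ, |t| < τ →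
      ∀ A ∈ convexHull ℝ (PureTensor n), (L₀ + t • L₁) A ∈ convexHull ℝ (PureTensor n) := by
  classical
  have hNpos : 1 ≤ ∏ i, n i := Finset.prod_pos fun i _ => lt_of_lt_of_le two_pos (h2 i)
  have hc : ((∏ i, n i : ℕ) : ℝ)⁻¹ •
      (1 : selfAdjoint (Matrix (∀ i, Fin (n i)) (∀ i, Fin (n i)) ℂ))
      ∈ convexHull ℝ (PureTensor n) := by
    let x : ∀ i, Fin (n i) := fun i => ⟨0, by have := h2 i; omega⟩
    choose c Q hQ hc using fun i => single_pure (x i) (x i)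
    have hq : ∀ i, IsPureState (Q i 0) := fun i => hQ i 0
    have := move_pure n h2 ⟨tensorPi fun i => Q i 0, tensorPi_herm _ hq⟩ ⟨_, hq, rfl⟩ 0
      (by rw [abs_zero]; positivity)
    simpa using this
  let E : (∀ i, Fin (n i)) → (∀ i, Fin (n i)) → Matrix (∀ i, Fin (n i)) (∀ i, Fin (n i)) ℂ :=
    fun x y => Matrix.single x y 1
  let B : ((∀ i, Fin (n i)) × (∀ i, Fin (n i))) × Bool →
      selfAdjoint (Matrix (∀ i, Fin (n i)) (∀ i, Fin (n i)) ℂ) :=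
    fun p => if p.2 then L₁ (ℜ (E p.1.1 p.1.2)) else L₁ (- ℑ (E p.1.1 p.1.2))
  obtain ⟨ε, hε, h⟩ := absorb_uniform _ (convex_convexHull ℝ (PureTensor n)) _ hc B
    (fun p => traceless_mem n h2 hc _ (by simp only [B]; split_ifs <;> exact hL₁ _)) Finset.univ
  refine ⟨ε, hε, fun t ht A hA => ?_⟩
  let a : ((∀ i, Fin (n i)) × (∀ i, Fin (n i))) × Bool → ℝ := fun p =>
    if p.2 then ((A : Matrix (∀ i, Fin (n i)) (∀ i, Fin (n i)) ℂ) p.1.1 p.1.2).re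
    else ((A : Matrix (∀ i, Fin (n i)) (∀ i, Fin (n i)) ℂ) p.1.1 p.1.2).im
  have ha : ∀ p, |a p| ≤ 1 := by
    intro p
    have := hull_entry n A hA p.1.1 p.1.2
    simp only [a]
    split_ifs
    · exact (Complex.abs_re_le_norm _).trans this
    · exact (Complex.abs_im_le_norm _).trans this
  convert h a ha t ht.le using 1
  have h0 : L₀ A = ((∏ i, n i : ℕ) : ℝ)⁻¹ •
      (1 : selfAdjoint (Matrix (∀ i, Fin (n i)) (∀ i, Fin (n i)) ℂ)) := by
    apply Subtype.ext
    rw [hL₀, hull_trace n A hA, hN]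
    ext x y
    simp [Matrix.one_apply]
  have h1 : L₁ A = ∑ p, a p • B p := by
    have hA' : ℜ (A : Matrix (∀ i, Fin (n i)) (∀ i, Fin (n i)) ℂ) = A :=
      Subtype.ext (IsSelfAdjoint.coe_realPart A.2)
    have hdec : A = ∑ x, ∑ y,
        (((A : Matrix (∀ i, Fin (n i)) (∀ i, Fin (n i)) ℂ) x y).re • ℜ (E x y) -
        ((A : Matrix (∀ i, Fin (n i)) (∀ i, Fin (n i)) ℂ) x y).im • ℑ (E x y)) := by
      conv_lhs => rw [← hA', Matrix.matrix_eq_sum_single (A : Matrix (∀ i, Fin (n i)) (∀ i, Fin (n i)) ℂ)]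
      simp only [map_sum]
      refine Finset.sum_congr rfl fun x _ => Finset.sum_congr rfl fun y _ => ?_
      rw [← realPart_smul]
      simp only [E, Matrix.smul_single, smul_eq_mul, mul_one]
    conv_lhs => rw [hdec]
    rw [Fintype.sum_prod_type, Fintype.sum_prod_type]
    simp only [map_sum, map_add, map_smul, Fintype.sum_bool, a, B, if_true, map_neg, smul_neg,
      Bool.false_eq_true, if_false, sub_eq_add_neg]
  rw [LinearMap.add_apply, LinearMap.smul_apply, h0, h1]
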